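/- Let p be an odd prime, q = p^m with q = 2^a·b − 1, b odd, a ≥ 2, let r ≥ 3, and N = 2^r·p^s. Let C be the ideal of R = F_q[x]/(x^N − 1) generated by m_0(x)^{j_0} · m_{2^{r−1}}(x)^{j_{2^{r−1}}} · m_{2^{r−2}}(x)^{j_{2^{r−2}}} · ∏_{i=3}^r ∏_{s ∈ O_i} m_{2^{r−i}s}(x)^{j_{2^{r−i}s}}, where 0 ≤ j_t ≤ p^s for each t ∈ T_n. Then C is MDS if and only if exactly one of the following holds: (1) j_t = 0 for every t ∈ T_n, in which case d_H(C) = 1; (2) exactly one of j_0, j_{2^{r−1}} equals 1 and all other exponents j_t are 0, in which case d_H(C) = 2; (3) exactly one of j_0, j_{2^{r−1}} equals p^s − 1 and all other exponents j_t equal p^s, in which case d_H(C) = 2^r·p^s. -/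

import Mathlib

open Polynomial
open scoped Classical

/-- The coefficient vector (with respect to the basis `1, x, …, x^{deg f − 1}` of
`F[x]/(f)`) of an element of `F[x]/(f)`. -/
noncomputable def coeffRepr {F : Type*} [Field F] {f : Polynomial F} (hf : f ≠ 0)
    (x : AdjoinRoot f) (i : Fin (AdjoinRoot.powerBasis hf).dim) : F :=
  (AdjoinRoot.powerBasis hf).basis.repr x i

/-- The Hamming weight of a codeword. -/
noncomputable def hammingWeight {F : Type*} [Field F] {f : Polynomial F} (hf : f ≠ 0)
    (x : AdjoinRoot f) : ℕ :=
  (Finset.univ.filter fun i => coeffRepr hf x i ≠ 0).card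

/-- The Hamming distance of a code `C ⊆ F[x]/(f)`. -/
noncomputable def dHamming {F : Type*} [Field F] {f : Polynomial F} (hf : f ≠ 0)
    (C : Ideal (AdjoinRoot f)) : ℕ :=
  sInf {w | ∃ x ∈ C, x ≠ 0 ∧ w = hammingWeight hf x}

/-- The set `O_i` for `q = 2^a·b − 1`, `a ≥ 2`. -/
def Ofin (a i : ℕ) : Finset ℤ :=
  if a = 2 then {1, -1}
  else if i ≤ a then (Finset.range (2 ^ (i - 2))).image fun v => (3 : ℤ) ^ v
  else
    ((Finset.range (2 ^ (a - 2))).image fun v => (3 : ℤ) ^ v) ∪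
      ((Finset.range (2 ^ (a - 2))).image fun v => -(3 : ℤ) ^ v)

/-- The complete set of representatives
`T_n = {0, 2^{r−1}, 2^{r−2}} ∪ ⋃_{i=3}^r 2^{r−i}·O_i`. -/
def TnO (a r : ℕ) : Finset ℤ :=
  {0, 2 ^ (r - 1), 2 ^ (r - 2)} ∪
    (Finset.Icc 3 r).biUnion fun i => (Ofin a i).image fun u => 2 ^ (r - i) * u


/-- A power of `1 + 2 ^ c * d` with exponent `2 ^ k` is `1` plus an odd multiple of `2 ^ (c + k)`. -/
theorem one_add_two_pow_mul_pow_two_pow {c : ℕ} (hc : 2 ≤ c) {d : ℤ} (hd : Odd d) (k : ℕ) :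
    ∃ e : ℤ, Odd e ∧ (1 + 2 ^ c * d) ^ 2 ^ k = 1 + 2 ^ (c + k) * e := by
  induction k with
  | zero => exact ⟨d, hd, by simp⟩
  | succ k ih =>
    obtain ⟨e, he, h⟩ := ih
    obtain ⟨l, hl⟩ : ∃ l, c + k = l + 1 := ⟨c + k - 1, by omega⟩
    have hl0 : l ≠ 0 := by omega
    refine ⟨e + 2 ^ l * e ^ 2, ?_, ?_⟩
    · exact he.add_even (((even_two (α := ℤ)).pow_of_ne_zero hl0).mul_right _)
    · rw [pow_succ 2 k, pow_mul, h, ← Nat.add_assoc, hl]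
      ring

theorem exists_two_pow_dvd_sub_mul_pow {c : ℕ} (hc : 2 ≤ c) {d : ℤ} (hd : Odd d) {x y : ℤ}
    (hy : Odd y) (hxy : 2 ^ c ∣ x - y) (k : ℕ) :
    ∃ l < 2 ^ k, (2 : ℤ) ^ (c + k) ∣ x - y * (1 + 2 ^ c * d) ^ l := by
  induction k with
  | zero => exact ⟨0, by simp, by simpa using hxy⟩
  | succ k ih =>
    obtain ⟨l, hl, z, hz⟩ := ih
    rcases Int.even_or_odd z with ⟨w, hw⟩ | hzo
    · exact ⟨l, hl.trans (by rw [pow_succ]; omega), w, by rw [hz, hw]; ring⟩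
    · obtain ⟨e, he, h⟩ := one_add_two_pow_mul_pow_two_pow hc hd k
      have hQ : Odd ((1 + 2 ^ c * d : ℤ) ^ l) :=
        (odd_one.add_even
          (((even_two (α := ℤ)).pow_of_ne_zero (by omega)).mul_right _)).pow
      obtain ⟨w, hw⟩ := hzo.sub_odd ((hy.mul hQ).mul he)
      refine ⟨l + 2 ^ k, by rw [pow_succ]; omega, w, ?_⟩
      rw [pow_add, h]
      have : z = y * (1 + 2 ^ c * d) ^ l * e + (w + w) := by linarith
      rw [this] at hz
      linear_combination hz

theorem two_pow_dvd_of_two_pow_dvd_pow_sub_one {c : ℕ} (hc : 2 ≤ c) {d : ℤ} (hd : Odd d)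
    {k l : ℕ} (h : (2 : ℤ) ^ (c + k) ∣ (1 + 2 ^ c * d) ^ l - 1) : 2 ^ k ∣ l := by
  have h4 : (4 : ℤ) ∣ 2 ^ c := pow_dvd_pow (2 : ℤ) hc
  have hodd : Odd (1 + 2 ^ c * d) :=
    odd_one.add_even (((even_two (α := ℤ)).pow_of_ne_zero (by omega)).mul_right _)
  have key := Int.two_pow_sub_pow' (x := 1 + 2 ^ c * d) (y := 1) l
    (by simpa using h4.mul_right d) (by rwa [← Int.not_even_iff_odd, even_iff_two_dvd] at hodd)
  have hmul : emultiplicity (2 : ℤ) (1 + 2 ^ c * d - 1) = c := by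
    rw [add_sub_cancel_left]
    refine emultiplicity_eq_coe.2 ⟨dvd_mul_right _ _, fun hdvd => ?_⟩
    rw [pow_succ, mul_dvd_mul_iff_left (by positivity)] at hdvd
    exact (Int.not_even_iff_odd.2 hd) (even_iff_two_dvd.2 hdvd)
  rw [one_pow, hmul] at key
  have h1 := le_emultiplicity_of_pow_dvd h
  rw [key, Nat.cast_add] at h1
  have h2 := (ENat.add_le_add_iff_left (ENat.natCast_ne_top c)).1 h1
  have h3 := pow_dvd_of_le_emultiplicity h2
  exact_mod_cast h3

theorem eq_of_two_pow_dvd_pow_sub_pow {c : ℕ} (hc : 2 ≤ c) {d : ℤ} (hd : Odd d)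
    {k v w : ℕ} (hv : v < 2 ^ k) (hw : w < 2 ^ k)
    (h : (2 : ℤ) ^ (c + k) ∣ (1 + 2 ^ c * d) ^ v - (1 + 2 ^ c * d) ^ w) : v = w := by
  wlog hle : w ≤ v generalizing v w
  · exact (this hw hv (dvd_sub_comm.1 h) (by omega)).symm
  have hodd : Odd (1 + 2 ^ c * d) :=
    odd_one.add_even (((even_two (α := ℤ)).pow_of_ne_zero (by omega)).mul_right _)
  obtain ⟨l, rfl⟩ := Nat.exists_eq_add_of_le hle
  have h' : (2 : ℤ) ^ (c + k) ∣ (1 + 2 ^ c * d) ^ l - 1 :=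
    IsCoprime.dvd_of_dvd_mul_left (y := (1 + 2 ^ c * d) ^ w)
      (Int.isCoprime_two_left.2 hodd).pow
      (by rwa [mul_sub, mul_one, ← pow_add])
  have hdvd := two_pow_dvd_of_two_pow_dvd_pow_sub_one hc hd h'
  rcases Nat.eq_zero_or_pos l with rfl | hl
  · rfl
  · have := Nat.le_of_dvd hl hdvd
    omega

/-- Representatives of the orbits of multiplication by `q` on the odd residues modulo `2 ^ i`. -/
def oddOrbitReps (a i : ℕ) : Finset ℤ := if i ≤ 2 then {1} else Ofin a i

theorem mem_oddOrbitReps {a i : ℕ} (ha : 2 ≤ a) {u : ℤ} :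
    u ∈ oddOrbitReps a i ↔ ∃ v < 2 ^ (min a i - 2), ∃ ε : ℤ,
      (ε = 1 ∨ ε = -1) ∧ (i ≤ a → ε = 1) ∧ u = ε * 3 ^ v := by
  unfold oddOrbitReps Ofin
  split_ifs with h1 h2 h3
  · have h : min a i - 2 = 0 := by omega
    have h' : i ≤ a := by omega
    rw [h]
    constructor
    · intro hu
      exact ⟨0, by simp, 1, by simp, by simp, by simpa using hu⟩
    · rintro ⟨v, hv, ε, -, hε, rfl⟩
      obtain rfl : v = 0 := by simpa using hv
      simp [hε h']
  · subst h2
    have h : min 2 i - 2 = 0 := by omega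
    rw [h]
    simp [h1]
  · have h : min a i = i := by omega
    rw [h]
    simp only [Finset.mem_image, Finset.mem_range]
    constructor
    · rintro ⟨v, hv, rfl⟩
      exact ⟨v, hv, 1, by simp, by simp, by ring⟩
    · rintro ⟨v, hv, ε, -, hε, rfl⟩
      exact ⟨v, hv, by rw [hε h3, one_mul]⟩
  · have h : min a i = a := by omega
    rw [h]
    simp only [Finset.mem_union, Finset.mem_image, Finset.mem_range, h3, IsEmpty.forall_iff,
      true_and]
    constructor
    · rintro (⟨v, hv, rfl⟩ | ⟨v, hv, rfl⟩)
      · exact ⟨v, hv, 1, Or.inl rfl, by ring⟩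
      · exact ⟨v, hv, -1, Or.inr rfl, by ring⟩
    · rintro ⟨v, hv, ε, rfl | rfl, rfl⟩
      · exact Or.inl ⟨v, hv, by ring⟩
      · exact Or.inr ⟨v, hv, by ring⟩

theorem odd_of_mem_oddOrbitReps {a i : ℕ} (ha : 2 ≤ a) {u : ℤ} (hu : u ∈ oddOrbitReps a i) :
    Odd u := by
  obtain ⟨v, -, ε, hε, -, rfl⟩ := (mem_oddOrbitReps ha).1 hu
  refine Odd.mul ?_ (Odd.pow (by decide))
  rcases hε with rfl | rfl <;> decide

theorem neg_one_pow_eq_one_or (n : ℕ) : (-1 : ℤ) ^ n = 1 ∨ (-1 : ℤ) ^ n = -1 :=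
  neg_one_pow_eq_or ℤ n

theorem four_dvd_pow_sub_one {x : ℤ} (hx : 4 ∣ x - 1) (n : ℕ) : 4 ∣ x ^ n - 1 := by
  simpa using hx.trans (sub_dvd_pow_sub_pow x 1 n)

section Cosets

variable {a : ℕ} {b q : ℤ}

theorem oddOrbitReps_eq_of_dvd (ha : 2 ≤ a) (hb : Odd b) (hq : q = 2 ^ a * b - 1) {i k : ℕ}
    (hi : 1 ≤ i) {u u' : ℤ} (hu : u ∈ oddOrbitReps a i) (hu' : u' ∈ oddOrbitReps a i)
    (h : 2 ^ i ∣ u * q ^ k - u') : u = u' := by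
  rcases hi.eq_or_lt with rfl | hi
  · simp only [oddOrbitReps, Nat.one_le_ofNat, if_true, Finset.mem_singleton] at hu hu'
    rw [hu, hu']
  obtain ⟨v, hv, ε, hε, hεi, rfl⟩ := (mem_oddOrbitReps ha).1 hu
  obtain ⟨v', hv', ε', hε', hεi', rfl⟩ := (mem_oddOrbitReps ha).1 hu'
  set Q : ℤ := 1 + 2 ^ a * -b with hQ
  set P : ℤ := 1 + 2 ^ 2 * (-1) with hP
  have hq' : q ^ k = (-1) ^ k * Q ^ k := by rw [← mul_pow, hq, hQ]; ring
  have h3 : ∀ n : ℕ, (3 : ℤ) ^ n = (-1) ^ n * P ^ n := fun n => by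
    rw [← mul_pow, hP]; norm_num
  have hQa : (2 : ℤ) ^ a ∣ Q ^ k - 1 := by
    have := sub_dvd_pow_sub_pow Q 1 k
    rw [one_pow] at this
    exact dvd_trans ⟨-b, by rw [hQ]; ring⟩ this
  have hQ4 : (4 : ℤ) ∣ Q ^ k - 1 := dvd_trans (pow_dvd_pow (2 : ℤ) ha) hQa
  have hP4 : ∀ n, (4 : ℤ) ∣ P ^ n - 1 := four_dvd_pow_sub_one (by rw [hP]; norm_num)
  have h4 : (4 : ℤ) ∣ ε * 3 ^ v * q ^ k - ε' * 3 ^ v' := dvd_trans (pow_dvd_pow (2 : ℤ) hi) h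
  have hsign : ε * (-1) ^ v * (-1) ^ k = ε' * (-1) ^ v' := by
    rw [hq', h3, h3] at h4
    obtain ⟨x, hx⟩ := hP4 v
    obtain ⟨y, hy⟩ := hP4 v'
    obtain ⟨z, hz⟩ := hQ4
    rw [sub_eq_iff_eq_add] at hx hy hz
    rw [hx, hy, hz] at h4
    rcases hε with rfl | rfl <;> rcases hε' with rfl | rfl <;>
    rcases neg_one_pow_eq_one_or v with e1 | e1 <;>
    rcases neg_one_pow_eq_one_or v' with e2 | e2 <;>
    rcases neg_one_pow_eq_one_or k with e3 | e3 <;>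
    rw [e1, e2, e3] at h4 ⊢ <;> ring_nf at h4 ⊢ <;> omega
  have hunit : IsUnit (ε' * (-1) ^ v') := by
    refine IsUnit.mul ?_ (IsUnit.pow _ (by simp))
    rcases hε' with rfl | rfl <;> simp
  have h' : (2 : ℤ) ^ i ∣ P ^ v * Q ^ k - P ^ v' := by
    rw [← hunit.dvd_mul_left]
    have e : ε' * (-1) ^ v' * (P ^ v * Q ^ k - P ^ v') = ε * 3 ^ v * q ^ k - ε' * 3 ^ v' := by
      rw [hq', h3, h3]
      linear_combination (-(P ^ v * Q ^ k)) * hsign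
    rwa [e]
  have hvv : v = v' := by
    refine eq_of_two_pow_dvd_pow_sub_pow (c := 2) le_rfl (d := -1) (by decide) hv hv' ?_
    rw [show 2 + (min a i - 2) = min a i by omega, ← hP]
    have e1 : (2 : ℤ) ^ min a i ∣ P ^ v * Q ^ k - P ^ v' :=
      dvd_trans (pow_dvd_pow 2 (min_le_right _ _)) h'
    have e2 : (2 : ℤ) ^ min a i ∣ P ^ v * (Q ^ k - 1) :=
      (dvd_trans (pow_dvd_pow 2 (min_le_left _ _)) hQa).mul_left _
    have e3 := dvd_sub e1 e2
    rwa [show P ^ v * Q ^ k - P ^ v' - P ^ v * (Q ^ k - 1) = P ^ v - P ^ v' by ring] at e3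
  subst hvv
  rcases le_or_gt i a with hia | hia
  · rw [hεi hia, hεi' hia]
  · have hPodd : Odd P := by rw [hP]; decide
    have hQi : (2 : ℤ) ^ (a + (i - a)) ∣ Q ^ k - 1 := by
      rw [show a + (i - a) = i by omega]
      refine IsCoprime.dvd_of_dvd_mul_left (y := P ^ v) (Int.isCoprime_two_left.2 hPodd).pow ?_
      rwa [mul_sub, mul_one]
    have hk := two_pow_dvd_of_two_pow_dvd_pow_sub_one ha hb.neg hQi
    have hk2 : Even k :=
      even_iff_two_dvd.2 (dvd_trans (dvd_pow_self 2 (by omega)) hk)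
    rw [hk2.neg_one_pow, mul_one] at hsign
    rw [mul_right_cancel₀ (pow_ne_zero _ (by norm_num)) hsign]

theorem exists_mem_oddOrbitReps (ha : 2 ≤ a) (hb : Odd b) (hq : q = 2 ^ a * b - 1) {i : ℕ}
    (hi : 1 ≤ i) {w : ℤ} (hw : Odd w) :
    ∃ u ∈ oddOrbitReps a i, ∃ l : ℕ, 2 ^ i ∣ w - u * q ^ l := by
  rcases hi.eq_or_lt with rfl | hi
  · exact ⟨1, by simp [oddOrbitReps], 0, by
      simpa using even_iff_two_dvd.1 (hw.sub_odd odd_one)⟩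
  obtain ⟨σ, hσ, hwσ⟩ : ∃ σ : ℤ, (σ = 1 ∨ σ = -1) ∧ 4 ∣ w - σ := by
    obtain ⟨z, rfl⟩ := hw
    rcases Int.even_or_odd z with ⟨y, rfl⟩ | ⟨y, rfl⟩
    · exact ⟨1, Or.inl rfl, y, by ring⟩
    · exact ⟨-1, Or.inr rfl, y + 1, by ring⟩
  have hσo : Odd σ := by rcases hσ with rfl | rfl <;> decide
  obtain ⟨v, hv, hwv⟩ := exists_two_pow_dvd_sub_mul_pow (c := 2) le_rfl (d := -1) (by decide)
    hσo (x := w) hwσ (min a i - 2)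
  rw [show 2 + (min a i - 2) = min a i by omega,
    show (1 + 2 ^ 2 * -1 : ℤ) = -1 * 3 by norm_num, mul_pow] at hwv
  have hsgn : ∀ l : ℕ, σ * (-1) ^ v * (-1) ^ l = 1 ∨ σ * (-1) ^ v * (-1) ^ l = -1 := by
    intro l
    rcases hσ with rfl | rfl <;> rcases neg_one_pow_eq_one_or v with e1 | e1 <;>
    rcases neg_one_pow_eq_one_or l with e2 | e2 <;> simp [e1, e2]
  rcases le_or_gt i a with hia | hia
  · rw [min_eq_right hia] at hwv
    refine ⟨3 ^ v, (mem_oddOrbitReps ha).2 ⟨v, hv, 1, Or.inl rfl, fun _ => rfl, by ring⟩, ?_⟩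
    rcases hsgn 0 with e | e
    · refine ⟨0, ?_⟩
      convert hwv using 2
      linear_combination (-3 ^ v) * e
    · refine ⟨1, ?_⟩
      have e2 : (2 : ℤ) ^ i ∣ 3 ^ v * (2 ^ a * b) :=
        ((pow_dvd_pow 2 hia).mul_right b).mul_left _
      have e3 := dvd_sub hwv e2
      have e4 : w - σ * ((-1) ^ v * 3 ^ v) - 3 ^ v * (2 ^ a * b) = w - 3 ^ v * q ^ 1 := by
        rw [hq]
        linear_combination (-3 ^ v) * e
      rwa [e4] at e3
  · rw [min_eq_left hia.le] at hwv
    obtain ⟨l, -, hl⟩ := exists_two_pow_dvd_sub_mul_pow ha hb.neg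
      (hσo.mul ((Odd.pow (by decide : Odd (-1 : ℤ))).mul (Odd.pow (by decide : Odd (3 : ℤ)))))
      hwv (i - a)
    refine ⟨σ * (-1) ^ v * (-1) ^ l * 3 ^ v, (mem_oddOrbitReps ha).2
      ⟨v, by rwa [min_eq_left hia.le] at hv ⊢, _, hsgn l, fun h => by omega, rfl⟩, l, ?_⟩
    rw [show a + (i - a) = i by omega] at hl
    convert hl using 2
    rw [show 1 + 2 ^ a * -b = -1 * q by rw [hq]; ring, mul_pow]
    ring

theorem mem_TnO {r : ℕ} (hr : 3 ≤ r) {t : ℤ} :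
    t ∈ TnO a r ↔ t = 0 ∨ ∃ i ∈ Finset.Icc 1 r, ∃ u ∈ oddOrbitReps a i, t = 2 ^ (r - i) * u := by
  simp only [TnO, Finset.mem_union, Finset.mem_insert, Finset.mem_singleton, Finset.mem_biUnion,
    Finset.mem_image, Finset.mem_Icc, oddOrbitReps]
  constructor
  · rintro ((rfl | rfl | rfl) | ⟨i, hi, u, hu, rfl⟩)
    · exact Or.inl rfl
    · exact Or.inr ⟨1, by omega, 1, by simp, by simp⟩
    · exact Or.inr ⟨2, by omega, 1, by simp, by simp⟩
    · exact Or.inr ⟨i, by omega, u, by rwa [if_neg (by omega)], rfl⟩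
  · rintro (rfl | ⟨i, hi, u, hu, rfl⟩)
    · simp
    · split_ifs at hu with h2
      · rw [Finset.mem_singleton] at hu
        subst hu
        obtain rfl | rfl : i = 1 ∨ i = 2 := by omega
        all_goals simp
      · exact Or.inr ⟨i, by omega, u, hu, rfl⟩

theorem TnO_eq_of_dvd (ha : 2 ≤ a) (hb : Odd b) (hq : q = 2 ^ a * b - 1) {r : ℕ} (hr : 3 ≤ r)
    {t t' : ℤ} (ht : t ∈ TnO a r) (ht' : t' ∈ TnO a r) {k : ℕ}
    (h : 2 ^ r ∣ t * q ^ k - t') : t = t' := by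
  have hqo : Odd (q ^ k) := by
    rw [hq]
    exact Odd.pow (Even.sub_odd (((even_two (α := ℤ)).pow_of_ne_zero (by omega)).mul_right _)
      odd_one)
  have hnot : ∀ i ∈ Finset.Icc 1 r, ∀ w : ℤ, Odd w → ¬ (2 : ℤ) ^ r ∣ 2 ^ (r - i) * w := by
    intro i hi w hw hdvd
    rw [Finset.mem_Icc] at hi
    rw [show r = r - i + i by omega, pow_add, Nat.add_sub_cancel,
      mul_dvd_mul_iff_left (by positivity)] at hdvd
    exact (Int.not_even_iff_odd.2 hw)
      (even_iff_two_dvd.2 ((dvd_pow_self 2 (by omega)).trans hdvd))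
  rcases (mem_TnO hr).1 ht with rfl | ⟨i, hi, u, hu, rfl⟩ <;>
  rcases (mem_TnO hr).1 ht' with rfl | ⟨i', hi', u', hu', rfl⟩
  · rfl
  · rw [zero_mul, zero_sub, dvd_neg] at h
    exact absurd h (hnot i' hi' u' (odd_of_mem_oddOrbitReps ha hu'))
  · rw [sub_zero, mul_assoc] at h
    exact absurd h (hnot i hi _ ((odd_of_mem_oddOrbitReps ha hu).mul hqo))
  have huo := odd_of_mem_oddOrbitReps ha hu
  have huo' := odd_of_mem_oddOrbitReps ha hu'
  rcases lt_trichotomy i i' with hlt | rfl | hlt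
  · have hi1 := Finset.mem_Icc.1 hi'
    refine absurd h ?_
    rw [show r - i = r - i' + (i' - i) by omega, pow_add, mul_assoc, mul_assoc, ← mul_sub]
    exact hnot i' hi' _ ((((even_two (α := ℤ)).pow_of_ne_zero (by omega)).mul_right _).sub_odd huo')
  · have hi1 := Finset.mem_Icc.1 hi
    rw [mul_assoc, ← mul_sub] at h
    nth_rewrite 1 [show r = r - i + i by omega] at h
    rw [pow_add, mul_dvd_mul_iff_left (by positivity)] at h
    rw [oddOrbitReps_eq_of_dvd ha hb hq hi1.1 hu hu' h]
  · have hi1 := Finset.mem_Icc.1 hi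
    refine absurd h ?_
    rw [show r - i' = r - i + (i - i') by omega, pow_add, mul_assoc, mul_assoc, ← mul_sub]
    exact hnot i hi _ ((huo.mul hqo).sub_even
      (((even_two (α := ℤ)).pow_of_ne_zero (by omega)).mul_right _))

theorem exists_mem_TnO (ha : 2 ≤ a) (hb : Odd b) (hq : q = 2 ^ a * b - 1) {r : ℕ} (hr : 3 ≤ r)
    (z : ℤ) : ∃ t ∈ TnO a r, ∃ l : ℕ, 2 ^ r ∣ z - t * q ^ l := by
  by_cases hz : (2 : ℤ) ^ r ∣ z
  · exact ⟨0, (mem_TnO hr).2 (Or.inl rfl), 0, by simpa using hz⟩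
  have hz0 : z ≠ 0 := by rintro rfl; simp at hz
  have hfin : FiniteMultiplicity (2 : ℤ) z := Int.finiteMultiplicity_iff.2 ⟨by decide, hz0⟩
  obtain ⟨w, hw, hw2⟩ := hfin.exists_eq_pow_mul_and_not_dvd
  generalize multiplicity (2 : ℤ) z = e at hw
  have her : e < r := by
    by_contra hge
    exact hz (hw ▸ (pow_dvd_pow 2 (by omega)).mul_right _)
  obtain ⟨u, hu, l, hl⟩ := exists_mem_oddOrbitReps ha hb hq (i := r - e) (by omega) (w := w)
    (by rwa [← Int.not_even_iff_odd, even_iff_two_dvd])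
  refine ⟨2 ^ (r - (r - e)) * u, (mem_TnO hr).2
    (Or.inr ⟨r - e, Finset.mem_Icc.2 (by omega), u, hu, rfl⟩), l, ?_⟩
  rw [show r - (r - e) = e by omega, hw, mul_assoc, ← mul_sub]
  nth_rewrite 1 [show r = e + (r - e) by omega]
  rw [pow_add]
  exact mul_dvd_mul_left _ hl

theorem two_pow_mul_odd_inj {k l : ℕ} {u v : ℤ} (hu : Odd u) (hv : Odd v)
    (h : 2 ^ k * u = 2 ^ l * v) : k = l ∧ u = v := by
  wlog hkl : k ≤ l generalizing k l u v
  · have := this hv hu h.symm (by omega)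
    exact ⟨this.1.symm, this.2.symm⟩
  obtain ⟨e, rfl⟩ := Nat.exists_eq_add_of_le hkl
  rw [pow_add, mul_assoc] at h
  have h' := mul_left_cancel₀ (by positivity) h
  rcases Nat.eq_zero_or_pos e with rfl | he
  · exact ⟨rfl, by simpa using h'⟩
  · refine absurd (h' ▸ hu) (Int.not_odd_iff_even.2 ?_)
    exact ((even_two (α := ℤ)).pow_of_ne_zero he.ne').mul_right _

theorem prod_TnO (ha : 2 ≤ a) {r : ℕ} (hr : 3 ≤ r) {M : Type*} [CommMonoid M] (f : ℤ → M) :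
    ∏ t ∈ TnO a r, f t = f 0 * f (2 ^ (r - 1)) * f (2 ^ (r - 2)) *
      ∏ i ∈ Finset.Icc 3 r, ∏ u ∈ Ofin a i, f (2 ^ (r - i) * u) := by
  have hodd : ∀ i ∈ Finset.Icc 3 r, ∀ u ∈ Ofin a i, Odd u := fun i hi u hu => by
    refine odd_of_mem_oddOrbitReps (i := i) ha ?_
    rw [Finset.mem_Icc] at hi
    rwa [oddOrbitReps, if_neg (by omega)]
  have hne : (2 : ℤ) ^ (r - 1) ≠ 2 ^ (r - 2) := fun h => by
    have := (two_pow_mul_odd_inj (k := r - 1) (l := r - 2) odd_one odd_one (by rw [h])).1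
    omega
  unfold TnO
  rw [Finset.prod_union, Finset.prod_biUnion, Finset.prod_insert, Finset.prod_insert,
    Finset.prod_singleton, ← mul_assoc]
  · congr 1
    refine Finset.prod_congr rfl fun i hi => Finset.prod_image fun u hu v hv h => ?_
    exact (two_pow_mul_odd_inj (hodd i hi u hu) (hodd i hi v hv) h).2
  · simpa using hne
  · simp [(pow_ne_zero _ two_ne_zero : (2 : ℤ) ^ (r - 1) ≠ 0).symm,
      (pow_ne_zero _ two_ne_zero : (2 : ℤ) ^ (r - 2) ≠ 0).symm]
  · intro i hi i' hi' hii
    refine Finset.disjoint_left.2 fun t ht ht' => hii ?_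
    obtain ⟨u, hu, rfl⟩ := Finset.mem_image.1 ht
    obtain ⟨u', hu', h⟩ := Finset.mem_image.1 ht'
    have := (two_pow_mul_odd_inj (hodd i' hi' u' hu') (hodd i hi u hu) h).1
    have h1 := Finset.mem_Icc.1 hi
    have h2 := Finset.mem_Icc.1 hi'
    omega
  · refine Finset.disjoint_left.2 fun t ht ht' => ?_
    obtain ⟨i, hi, ht'⟩ := Finset.mem_biUnion.1 ht'
    obtain ⟨u, hu, rfl⟩ := Finset.mem_image.1 ht'
    have hu := hodd i hi u hu
    have h1 := Finset.mem_Icc.1 hi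
    simp only [Finset.mem_insert, Finset.mem_singleton] at ht
    rcases ht with h | h | h
    · exact mul_ne_zero (pow_ne_zero _ two_ne_zero) (by rintro rfl; simp at hu) h
    all_goals
      have := (two_pow_mul_odd_inj hu odd_one (by rw [mul_one]; exact h)).1
      omega

end Cosets

section ConjugatesOverFiniteField

variable {F : Type*} [Field F] [Fintype F] {E : Type*} [Field E] [Algebra F E]

theorem minpoly_pow_card_pow (x : E) (k : ℕ) :
    minpoly F (x ^ Fintype.card F ^ k) = minpoly F x := by
  induction k with
  | zero => simp
  | succ k ih =>
    rw [pow_succ, pow_mul, ← ih]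
    exact minpoly.algHom_eq (FiniteField.frobeniusAlgHom F E) (RingHom.injective _) _

theorem exists_eq_pow_card_pow_of_minpoly_eq {x y : E} (hx : IsIntegral F x)
    (hy : IsIntegral F y) (h : minpoly F x = minpoly F y) :
    ∃ k : ℕ, x ^ Fintype.card F ^ k = y := by
  let L := IntermediateField.adjoin F ({x, y} : Set E)
  have : FiniteDimensional F L := by
    refine IntermediateField.finiteDimensional_adjoin ?_
    rintro z (rfl | rfl)
    exacts [hx, hy]
  have : Finite L := Module.finite_of_finite F
  let x' : L := ⟨x, IntermediateField.subset_adjoin F _ (by simp)⟩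
  let y' : L := ⟨y, IntermediateField.subset_adjoin F _ (by simp)⟩
  have hx' : minpoly F x' = minpoly F x := (minpoly.algHom_eq L.val L.val.injective x').symm
  have hy' : minpoly F y' = minpoly F y := (minpoly.algHom_eq L.val L.val.injective y').symm
  have hc : IsConjRoot F y' x' := by
    rw [isConjRoot_def, hx', hy', h]
  obtain ⟨σ, hσ⟩ := isConjRoot_iff_exists_algEquiv.1 hc
  obtain ⟨k, hk⟩ := (FiniteField.bijective_frobeniusAlgEquivOfAlgebraic_pow F L).2 σ
  refine ⟨k, ?_⟩
  have h1 : x' ^ Fintype.card F ^ (k : ℕ) = y' := by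
    rw [← hσ, ← hk]
    simp [AlgEquiv.coe_pow, FiniteField.coe_frobeniusAlgEquivOfAlgebraic_iterate]
  exact congrArg Subtype.val h1

variable {a r : ℕ} {b : ℤ} {β : E}

theorem isIntegral_zpow_of_isPrimitiveRoot {F E : Type*} [Field F] [Field E] [Algebra F E] {β : E}
    {n : ℕ} (hn : 0 < n) (hβ : IsPrimitiveRoot β n) (t : ℤ) : IsIntegral F (β ^ t) := by
  refine IsIntegral.of_pow hn ?_
  rw [← zpow_natCast, zpow_comm, zpow_natCast, hβ.pow_eq_one, one_zpow]
  exact isIntegral_one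

theorem zpow_eq_zpow_iff_dvd {E : Type*} [Field E] {β : E} {n : ℕ} (hn : 0 < n) (hβ : IsPrimitiveRoot β n) (u v : ℤ) :
    β ^ u = β ^ v ↔ (n : ℤ) ∣ u - v := by
  have h0 : β ≠ 0 := hβ.ne_zero hn.ne'
  rw [← hβ.zpow_eq_one_iff_dvd, zpow_sub₀ h0, div_eq_one_iff_eq (zpow_ne_zero _ h0)]

theorem minpoly_zpow_injOn_TnO (ha : 2 ≤ a) (hb : Odd b)
    (hq : (Fintype.card F : ℤ) = 2 ^ a * b - 1) (hr : 3 ≤ r) (hβ : IsPrimitiveRoot β (2 ^ r)) :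
    Set.InjOn (fun t : ℤ => minpoly F (β ^ t)) (TnO a r) := by
  intro t ht t' ht' h
  have hint := isIntegral_zpow_of_isPrimitiveRoot (F := F) (by positivity) hβ
  obtain ⟨k, hk⟩ := exists_eq_pow_card_pow_of_minpoly_eq (hint t) (hint t') h
  rw [← zpow_natCast, ← zpow_mul, zpow_eq_zpow_iff_dvd (by positivity) hβ] at hk
  push_cast at hk
  exact TnO_eq_of_dvd ha hb hq hr ht ht' hk

theorem prod_minpoly_zpow_TnO (ha : 2 ≤ a) (hb : Odd b)
    (hq : (Fintype.card F : ℤ) = 2 ^ a * b - 1) (hr : 3 ≤ r) (hβ : IsPrimitiveRoot β (2 ^ r)) :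
    ∏ t ∈ TnO a r, minpoly F (β ^ t) = X ^ 2 ^ r - 1 := by
  have hpos : 0 < 2 ^ r := by positivity
  have hint := isIntegral_zpow_of_isPrimitiveRoot (F := F) hpos hβ
  refine eq_of_monic_of_associated (monic_prod_of_monic _ _ fun t _ => minpoly.monic (hint t))
    (by simpa using monic_X_pow_sub_C (1 : F) hpos.ne') (associated_of_dvd_dvd ?_ ?_)
  · refine Finset.prod_dvd_of_coprime (fun t ht t' ht' hne => ?_) fun t _ => ?_
    · refine (minpoly.irreducible (hint t)).coprime_iff_not_dvd.2 fun hdvd => hne ?_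
      exact minpoly_zpow_injOn_TnO (F := F) ha hb hq hr hβ ht ht' (eq_of_monic_of_associated
        (minpoly.monic (hint t)) (minpoly.monic (hint t'))
        ((minpoly.irreducible (hint t)).associated_of_dvd (minpoly.irreducible (hint t')) hdvd))
    · refine minpoly.dvd _ _ ?_
      rw [map_sub, map_pow, aeval_X, map_one, ← zpow_natCast, zpow_comm, zpow_natCast,
        hβ.pow_eq_one, one_zpow, sub_self]
  · rw [← map_dvd_map' (algebraMap F E), Polynomial.map_sub, Polynomial.map_pow, map_X,
      Polynomial.map_one, X_pow_sub_one_eq_prod hpos hβ]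
    refine Finset.prod_dvd_of_coprime
      (fun x _ y _ hne => isCoprime_X_sub_C_of_isUnit_sub (sub_ne_zero.2 hne).isUnit) ?_
    intro x hx
    rw [Polynomial.mem_nthRootsFinset hpos] at hx
    have : NeZero (2 ^ r) := ⟨hpos.ne'⟩
    obtain ⟨i, -, rfl⟩ := hβ.eq_pow_of_pow_eq_one hx
    obtain ⟨t, ht, l, hl⟩ := exists_mem_TnO ha hb hq hr i
    have hx : β ^ i = (β ^ t) ^ Fintype.card F ^ l := by
      rw [← zpow_natCast, ← zpow_natCast, ← zpow_mul, zpow_eq_zpow_iff_dvd hpos hβ]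
      exact_mod_cast hl
    rw [dvd_iff_isRoot, IsRoot.def, eval_map_algebraMap, hx]
    rw [← Finset.mul_prod_erase _ _ ht, map_mul, ← minpoly_pow_card_pow (β ^ t) l, minpoly.aeval,
      zero_mul]

theorem natDegree_minpoly_zpow_eq_one_iff (ha : 2 ≤ a) (hb : Odd b)
    (hq : (Fintype.card F : ℤ) = 2 ^ a * b - 1) (hr : 3 ≤ r) (hβ : IsPrimitiveRoot β (2 ^ r))
    {t : ℤ} (ht : t ∈ TnO a r) :
    (minpoly F (β ^ t)).natDegree = 1 ↔ t ∈ ({0, 2 ^ (r - 1)} : Finset ℤ) := by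
  have hpos : 0 < 2 ^ r := by positivity
  rw [minpoly.natDegree_eq_one_iff]
  constructor
  · rintro ⟨c, hc⟩
    have h1 : (β ^ t) ^ Fintype.card F = β ^ t := by
      rw [← hc, ← map_pow, FiniteField.pow_card]
    rw [← zpow_natCast, ← zpow_mul, zpow_eq_zpow_iff_dvd hpos hβ, hq] at h1
    have h2 : (2 : ℤ) ^ (r - 1) ∣ t := by
      have hodd : Odd (2 ^ (a - 1) * b - 1) := Even.sub_odd
        (((even_two (α := ℤ)).pow_of_ne_zero (by omega)).mul_right _) odd_one
      refine IsCoprime.dvd_of_dvd_mul_right (Int.isCoprime_two_left.2 hodd).pow_left ?_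
      rw [← mul_dvd_mul_iff_left two_ne_zero, ← pow_succ', Nat.sub_add_cancel (by omega)]
      obtain ⟨a, rfl⟩ : ∃ k, a = k + 1 := ⟨a - 1, by omega⟩
      push_cast at h1
      rw [Nat.add_sub_cancel]
      rwa [show t * (2 ^ (a + 1) * b - 1) - t = 2 * (t * (2 ^ a * b - 1)) by ring] at h1
    have h2r : (2 : ℤ) ^ r = 2 ^ (r - 1) * 2 := by
      rw [← pow_succ, Nat.sub_add_cancel (by omega)]
    obtain ⟨z, rfl⟩ := h2
    rw [Finset.mem_insert, Finset.mem_singleton]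
    rcases Int.even_or_odd z with ⟨y, rfl⟩ | ⟨y, rfl⟩
    · refine Or.inl (TnO_eq_of_dvd ha hb hq hr ht (by simp [TnO]) (k := 0) ⟨y, ?_⟩)
      rw [h2r]
      ring
    · refine Or.inr (TnO_eq_of_dvd ha hb hq hr ht (by simp [TnO]) (k := 0) ⟨y, ?_⟩)
      rw [h2r]
      ring
  · rw [Finset.mem_insert, Finset.mem_singleton]
    rintro (rfl | rfl)
    · exact ⟨1, by simp⟩
    · have h : (β ^ (2 : ℤ) ^ (r - 1)) ^ 2 = 1 := by
        rw [← zpow_natCast, ← zpow_mul, hβ.zpow_eq_one_iff_dvd]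
        push_cast
        rw [← pow_succ, Nat.sub_add_cancel (by omega)]
      rcases mul_self_eq_one_iff.1 ((sq _).symm.trans h) with h | h
      · exact ⟨1, by simp [h]⟩
      · exact ⟨-1, by simp [h]⟩

end ConjugatesOverFiniteField

section CyclicCodes

variable {F : Type*} [Field F]

theorem coeffRepr_mk {f : F[X]} (hf : f ≠ 0) {P : F[X]} (hP : P.natDegree < f.natDegree)
    (i : Fin (AdjoinRoot.powerBasis hf).dim) :
    coeffRepr hf (AdjoinRoot.mk f P) i = P.coeff i := by
  have hdim : (AdjoinRoot.powerBasis hf).dim = f.natDegree := AdjoinRoot.powerBasis_dim hf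
  have h : AdjoinRoot.mk f P = ∑ i : Fin (AdjoinRoot.powerBasis hf).dim,
      P.coeff i • (AdjoinRoot.powerBasis hf).basis i := by
    conv_lhs => rw [P.as_sum_range' (AdjoinRoot.powerBasis hf).dim (hdim ▸ hP)]
    rw [map_sum, ← Fin.sum_univ_eq_sum_range fun i => AdjoinRoot.mk f (monomial i (P.coeff i))]
    refine Finset.sum_congr rfl fun i _ => ?_
    rw [PowerBasis.basis_eq_pow, AdjoinRoot.powerBasis_gen, ← C_mul_X_pow_eq_monomial, map_mul,
      map_pow, AdjoinRoot.mk_X, AdjoinRoot.mk_C, Algebra.smul_def, AdjoinRoot.algebraMap_eq]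
  rw [coeffRepr, h, Module.Basis.repr_sum_self]

theorem hammingWeight_mk {f : F[X]} (hf : f ≠ 0) {P : F[X]} (hP : P.natDegree < f.natDegree) :
    hammingWeight hf (AdjoinRoot.mk f P) = P.support.card := by
  have hdim : (AdjoinRoot.powerBasis hf).dim = f.natDegree := AdjoinRoot.powerBasis_dim hf
  refine Finset.card_bij (fun i _ => (i : ℕ)) ?_ (fun i _ j _ h => Fin.ext h) ?_
  · intro i hi
    simpa [coeffRepr_mk hf hP] using hi
  · intro k hk
    have hk' : k < (AdjoinRoot.powerBasis hf).dim :=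
      hdim ▸ (le_natDegree_of_mem_supp k hk).trans_lt hP
    exact ⟨⟨k, hk'⟩, by simpa [coeffRepr_mk hf hP] using hk, rfl⟩

theorem exists_mk_eq_natDegree_lt {f : F[X]} (hf : 0 < f.natDegree) (x : AdjoinRoot f) :
    ∃ P : F[X], P.natDegree < f.natDegree ∧ AdjoinRoot.mk f P = x := by
  obtain ⟨P, rfl⟩ := AdjoinRoot.mk_surjective x
  refine ⟨P % f, natDegree_mod_lt P hf.ne', AdjoinRoot.mk_eq_mk.2 ?_⟩
  exact ⟨-(P / f), by rw [EuclideanDomain.mod_eq_sub_mul_div]; ring⟩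

theorem natDegree_X_pow_sub_one (N : ℕ) : (X ^ N - 1 : F[X]).natDegree = N := by
  simpa using natDegree_X_pow_sub_C (n := N) (r := (1 : F))

theorem card_support_sum_monomial_le {ι : Type*} (S : Finset ι) (e : ι → ℕ) (c : ι → F) :
    (∑ i ∈ S, monomial (e i) (c i)).support.card ≤ S.card := by
  refine (Finset.card_le_card (t := S.image e) fun k hk => ?_).trans Finset.card_image_le
  rw [mem_support_iff, finsetSum_coeff] at hk
  obtain ⟨i, hi, hik⟩ := Finset.exists_ne_zero_of_sum_ne_zero hk
  rw [coeff_monomial] at hik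
  exact Finset.mem_image.2 ⟨i, hi, by by_contra h; simp [h] at hik⟩

theorem card_support_pow_char_pow_le (p s : ℕ) [Fact p.Prime] [CharP F p] (h : F[X]) :
    (h ^ p ^ s).support.card ≤ h.natDegree + 1 := by
  have e : h ^ p ^ s = ∑ i ∈ h.support, monomial (i * p ^ s) (h.coeff i ^ p ^ s) := by
    conv_lhs => rw [h.as_sum_support]
    rw [sum_pow_char_pow]
    exact Finset.sum_congr rfl fun i _ => by rw [monomial_pow]
  rw [e]
  exact (card_support_sum_monomial_le _ _ _).trans (card_supp_le_succ_natDegree h)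

theorem card_support_X_pow_sub_one_pow_le (n k : ℕ) :
    ((X ^ n - 1 : F[X]) ^ k).support.card ≤ k + 1 := by
  have e : (X ^ n - 1 : F[X]) ^ k =
      ∑ i ∈ Finset.range (k + 1), monomial (n * i) ((-1) ^ (k - i) * (k.choose i : F)) := by
    rw [sub_eq_add_neg, add_pow]
    refine Finset.sum_congr rfl fun i _ => ?_
    rw [← C_mul_X_pow_eq_monomial, ← pow_mul]
    simp only [map_mul, map_pow, map_neg, map_one, map_natCast]
    ring
  rw [e]
  simpa using card_support_sum_monomial_le (F := F) (Finset.range (k + 1)) _ _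

theorem hammingWeight_mk_le {N : ℕ} (hN : 0 < N) (hf : (X ^ N - 1 : F[X]) ≠ 0) (P : F[X]) :
    hammingWeight hf (AdjoinRoot.mk _ P) ≤ P.support.card := by
  set Q : F[X] := ∑ i ∈ P.support, monomial (i % N) (P.coeff i) with hQ
  have hroot : AdjoinRoot.root (X ^ N - 1 : F[X]) ^ N = 1 := by
    have := AdjoinRoot.mk_self (f := (X ^ N - 1 : F[X]))
    rwa [map_sub, map_pow, AdjoinRoot.mk_X, map_one, sub_eq_zero] at this
  have hPQ : AdjoinRoot.mk (X ^ N - 1 : F[X]) P = AdjoinRoot.mk _ Q := by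
    conv_lhs => rw [P.as_sum_support]
    rw [hQ, map_sum, map_sum]
    refine Finset.sum_congr rfl fun i _ => ?_
    rw [← C_mul_X_pow_eq_monomial, ← C_mul_X_pow_eq_monomial, map_mul, map_mul, map_pow, map_pow,
      AdjoinRoot.mk_X]
    congr 1
    conv_lhs => rw [← Nat.div_add_mod i N, pow_add, pow_mul, hroot, one_pow, one_mul]
  have hdeg : Q.natDegree < N := by
    refine (natDegree_sum_le_of_forall_le _ _ (n := N - 1) fun i _ => ?_).trans_lt (by omega)
    have := Nat.mod_lt i hN
    exact (natDegree_monomial_le _).trans (by omega)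
  rw [hPQ, hammingWeight_mk hf (by rwa [natDegree_X_pow_sub_one])]
  exact card_support_sum_monomial_le _ _ _

theorem mk_mem_span_mk_iff {f g P : F[X]} (hg : g ∣ f) :
    AdjoinRoot.mk f P ∈ Ideal.span {AdjoinRoot.mk f g} ↔ g ∣ P := by
  rw [Ideal.mem_span_singleton]
  constructor
  · rintro ⟨x, hx⟩
    obtain ⟨h, rfl⟩ := AdjoinRoot.mk_surjective x
    rw [← map_mul, AdjoinRoot.mk_eq_mk] at hx
    exact (dvd_sub_left (dvd_mul_right g h)).1 (hg.trans hx)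
  · exact map_dvd _

theorem finrank_span_mk_add_natDegree {f g : F[X]} (hf : f ≠ 0) (hg : g ∣ f) :
    Module.finrank F ((Ideal.span {AdjoinRoot.mk f g}).restrictScalars F) + g.natDegree =
      f.natDegree := by
  have hg0 : g ≠ 0 := ne_zero_of_dvd_ne_zero hf hg
  have : Module.Finite F (AdjoinRoot f) := (AdjoinRoot.powerBasis hf).finite
  let φ := (AdjoinRoot.algHomOfDvd F f g hg).toLinearMap
  have hφ : ∀ P, φ (AdjoinRoot.mk f P) = AdjoinRoot.mk g P := fun P => by
    rw [AlgHom.toLinearMap_apply, ← AdjoinRoot.aeval_eq, ← AdjoinRoot.aeval_eq, ← aeval_algHom_apply,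
      AdjoinRoot.algHomOfDvd_root]
  have hrange : LinearMap.range φ = ⊤ := by
    rw [LinearMap.range_eq_top]
    intro y
    obtain ⟨P, rfl⟩ := AdjoinRoot.mk_surjective y
    exact ⟨_, hφ P⟩
  have hker : LinearMap.ker φ = (Ideal.span {AdjoinRoot.mk f g}).restrictScalars F := by
    ext x
    obtain ⟨P, rfl⟩ := AdjoinRoot.mk_surjective x
    rw [LinearMap.mem_ker, hφ, AdjoinRoot.mk_eq_zero, Submodule.restrictScalars_mem,
      mk_mem_span_mk_iff hg]
  have h := φ.finrank_range_add_finrank_ker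
  rw [hrange, hker, finrank_top, (AdjoinRoot.powerBasis hf).finrank,
    (AdjoinRoot.powerBasis hg0).finrank, AdjoinRoot.powerBasis_dim,
    AdjoinRoot.powerBasis_dim] at h
  omega

theorem dHamming_bot {f : F[X]} (hf : f ≠ 0) : dHamming hf ⊥ = 0 := by
  have : {w | ∃ x ∈ (⊥ : Ideal (AdjoinRoot f)), x ≠ 0 ∧ w = hammingWeight hf x} = ∅ := by
    ext w
    simp +contextual
  rw [dHamming, this, Nat.sInf_empty]

theorem dHamming_le_card_support {N : ℕ} (hN : 0 < N) (hf : (X ^ N - 1 : F[X]) ≠ 0) {g P : F[X]}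
    (hgP : g ∣ P) (hP : ¬ (X ^ N - 1 : F[X]) ∣ P) :
    dHamming hf (Ideal.span {AdjoinRoot.mk _ g}) ≤ P.support.card := by
  refine le_trans (Nat.sInf_le ?_) (hammingWeight_mk_le hN hf P)
  refine ⟨AdjoinRoot.mk _ P, ?_, ?_, rfl⟩
  · exact Ideal.mem_span_singleton.2 (map_dvd _ hgP)
  · rwa [Ne, AdjoinRoot.mk_eq_zero]

theorem le_dHamming {N : ℕ} (hN : 0 < N) (hf : (X ^ N - 1 : F[X]) ≠ 0) {g : F[X]} {d : ℕ}
    (hg : g ∣ X ^ N - 1) (hgN : ¬ (X ^ N - 1 : F[X]) ∣ g)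
    (h : ∀ P : F[X], P ≠ 0 → P.natDegree < N → g ∣ P → d ≤ P.support.card) :
    d ≤ dHamming hf (Ideal.span {AdjoinRoot.mk _ g}) := by
  refine le_csInf ⟨_, AdjoinRoot.mk _ g, Ideal.mem_span_singleton_self _, ?_, rfl⟩ ?_
  · rwa [Ne, AdjoinRoot.mk_eq_zero]
  · rintro w ⟨x, hx, hx0, rfl⟩
    obtain ⟨P, hP, rfl⟩ :=
      exists_mk_eq_natDegree_lt (by rwa [natDegree_X_pow_sub_one]) x
    rw [hammingWeight_mk hf hP]
    rw [natDegree_X_pow_sub_one] at hP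
    exact h P (by rintro rfl; simp at hx0) hP ((mk_mem_span_mk_iff hg).1 hx)

theorem not_X_pow_sub_one_dvd {N : ℕ} {P : F[X]} (hP : P ≠ 0) (h : P.natDegree < N) :
    ¬ (X ^ N - 1 : F[X]) ∣ P := fun hdvd => by
  have := natDegree_le_of_dvd hdvd hP
  rw [natDegree_X_pow_sub_one] at this
  omega

theorem dHamming_span_mk_one {N : ℕ} (hN : 0 < N) (hf : (X ^ N - 1 : F[X]) ≠ 0) :
    dHamming hf (Ideal.span {AdjoinRoot.mk _ 1}) = 1 := by
  have h1 : ¬ (X ^ N - 1 : F[X]) ∣ 1 := not_X_pow_sub_one_dvd one_ne_zero (by simpa)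
  refine le_antisymm ((dHamming_le_card_support hN hf dvd_rfl h1).trans ?_) ?_
  · exact (card_supp_le_succ_natDegree _).trans (by simp)
  · refine le_dHamming hN hf (one_dvd _) h1 fun P hP _ _ => ?_
    exact Finset.card_pos.2 (nonempty_support_iff.2 hP)

theorem X_sub_C_dvd_X_pow_sub_one {N : ℕ} {c : F} (hc : c ^ N = 1) :
    X - C c ∣ (X ^ N - 1 : F[X]) := by
  rw [dvd_iff_isRoot]
  simp [hc]

theorem ne_zero_of_pow_eq_one {N : ℕ} (hN : 0 < N) {c : F} (hc : c ^ N = 1) : c ≠ 0 := by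
  rintro rfl
  simp [hN.ne'] at hc

theorem dHamming_span_mk_X_sub_C {N : ℕ} (hN : 1 < N) (hf : (X ^ N - 1 : F[X]) ≠ 0) {c : F}
    (hc : c ^ N = 1) : dHamming hf (Ideal.span {AdjoinRoot.mk _ (X - C c)}) = 2 := by
  have hc0 := ne_zero_of_pow_eq_one (by omega) hc
  have h1 : ¬ (X ^ N - 1 : F[X]) ∣ X - C c :=
    not_X_pow_sub_one_dvd (X_sub_C_ne_zero c) (by rwa [natDegree_X_sub_C])
  refine le_antisymm ((dHamming_le_card_support (by omega) hf dvd_rfl h1).trans ?_) ?_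
  · exact (card_supp_le_succ_natDegree _).trans (by simp)
  · refine le_dHamming (by omega) hf (X_sub_C_dvd_X_pow_sub_one hc) h1 fun P hP _ hdvd => ?_
    by_contra! hlt
    have hpos : 0 < P.support.card := Finset.card_pos.2 (nonempty_support_iff.2 hP)
    obtain ⟨k, x, hx, rfl⟩ := card_support_eq_one.1 (by omega : P.support.card = 1)
    rw [dvd_iff_isRoot, IsRoot.def] at hdvd
    simp [hx, hc0] at hdvd

theorem dHamming_span_mk_of_mul_X_sub_C {N : ℕ} (hN : 0 < N) (hf : (X ^ N - 1 : F[X]) ≠ 0) {c : F}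
    (hc : c ^ N = 1) {g : F[X]} (hg : g * (X - C c) = X ^ N - 1) :
    dHamming hf (Ideal.span {AdjoinRoot.mk _ g}) = N := by
  have hc0 := ne_zero_of_pow_eq_one hN hc
  have hg0 : g ≠ 0 := by rintro rfl; exact hf (by rw [← hg, zero_mul])
  have hdeg : g.natDegree + 1 = N := by
    rw [← natDegree_X_pow_sub_one (F := F) N, ← hg, natDegree_mul hg0 (X_sub_C_ne_zero c),
      natDegree_X_sub_C]
  have hgsum : g = ∑ i ∈ Finset.range N, X ^ i * C c ^ (N - 1 - i) := by
    refine mul_right_cancel₀ (X_sub_C_ne_zero c) ?_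
    rw [hg, (Commute.all X (C c)).geom_sum₂_mul, ← C_pow, hc, C_1]
  have hsupp : g.support = Finset.range N := by
    ext k
    rw [mem_support_iff, hgsum, finsetSum_coeff]
    simp only [← C_pow, coeff_mul_C, coeff_X_pow]
    simp [hc0]
  have hnd : ¬ (X ^ N - 1 : F[X]) ∣ g := not_X_pow_sub_one_dvd hg0 (by omega)
  refine le_antisymm ((dHamming_le_card_support hN hf dvd_rfl hnd).trans ?_) ?_
  · rw [hsupp, Finset.card_range]
  · refine le_dHamming hN hf ⟨_, hg.symm⟩ hnd fun P hP hPN ⟨h, hh⟩ => ?_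
    have hh0 : h ≠ 0 := by rintro rfl; exact hP (by rw [hh, mul_zero])
    have hh1 : h.natDegree = 0 := by
      rw [hh, natDegree_mul hg0 hh0] at hPN
      omega
    obtain ⟨e, rfl⟩ := natDegree_eq_zero.1 hh1
    have he : e ≠ 0 := by simpa using hh0
    have hsupp' : P.support = g.support := by
      ext k
      simp [hh, he]
    rw [hsupp', hsupp, Finset.card_range]

theorem natDegree_prod_pow_eq {ι : Type*} (T : Finset ι) {M : ι → F[X]}
    (hM : ∀ t ∈ T, (M t).Monic) (j : ι → ℕ) :
    (∏ t ∈ T, M t ^ j t).natDegree = ∑ t ∈ T, j t * (M t).natDegree := by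
  rw [natDegree_prod_of_monic _ _ fun t ht => (hM t ht).pow _]
  exact Finset.sum_congr rfl fun t _ => natDegree_pow _ _

section Factored

variable {p s n : ℕ} [Fact p.Prime] [CharP F p] {ι : Type*} {T : Finset ι} {M : ι → F[X]}
  {j : ι → ℕ}

theorem X_pow_sub_one_eq_prod_pow (hprod : ∏ t ∈ T, M t = X ^ n - 1) :
    (X ^ (n * p ^ s) - 1 : F[X]) = ∏ t ∈ T, M t ^ p ^ s := by
  rw [Finset.prod_pow, hprod, sub_pow_char_pow, one_pow, pow_mul]

/-- If the generator omits one irreducible factor of `X ^ n - 1`, then raising the product of the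
factors that do occur to the power `p ^ s` gives a codeword of small weight. -/
theorem le_one_of_natDegree_lt_dHamming (hn : 0 < n) (hs : 0 < s)
    (hM : ∀ t ∈ T, (M t).Monic) (hirr : ∀ t ∈ T, Irreducible (M t))
    (hprod : ∏ t ∈ T, M t = X ^ n - 1) (hj : ∀ t ∈ T, j t ≤ p ^ s)
    (hf : (X ^ (n * p ^ s) - 1 : F[X]) ≠ 0) {t₀ : ι} (ht₀ : t₀ ∈ T) (hjt₀ : j t₀ = 0)
    (hd : (∏ t ∈ T, M t ^ j t).natDegree <
      dHamming hf (Ideal.span {AdjoinRoot.mk _ (∏ t ∈ T, M t ^ j t)})) :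
    (∀ t ∈ T, j t ≤ 1) ∧ (∏ t ∈ T, M t ^ j t).natDegree ≤ 1 := by
  have hps : 1 < p ^ s := Nat.one_lt_pow hs.ne' (Fact.out : p.Prime).one_lt
  have hN : 0 < n * p ^ s := by positivity
  have hdpos : ∀ t ∈ T, 0 < (M t).natDegree := fun t ht => (hirr t ht).natDegree_pos
  have hsumn : ∑ t ∈ T, (M t).natDegree = n := by
    rw [← natDegree_prod_of_monic _ _ hM, hprod, natDegree_X_pow_sub_one]
  have hle : ∀ t ∈ T, j t ≤ 1 := by
    set S := T.filter fun t => j t ≠ 0 with hS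
    have hST : S ⊆ T := Finset.filter_subset _ _
    have hSM : ∀ t ∈ S, (M t).Monic := fun t ht => hM t (hST ht)
    have hdegS : (∏ t ∈ S, M t).natDegree = ∑ t ∈ S, (M t).natDegree :=
      natDegree_prod_of_monic _ _ hSM
    have hlt : ∑ t ∈ S, (M t).natDegree < n := by
      rw [← hsumn]
      exact Finset.sum_lt_sum_of_subset hST ht₀ (by simp [hS, hjt₀]) (hdpos _ ht₀)
        fun _ _ _ => Nat.zero_le _
    have hgS : ∏ t ∈ T, M t ^ j t = ∏ t ∈ S, M t ^ j t := by
      refine (Finset.prod_subset hST fun t ht hnt => ?_).symm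
      have : j t = 0 := by simpa [hS, ht] using hnt
      rw [this, pow_zero]
    have hdvd : ∏ t ∈ T, M t ^ j t ∣ (∏ t ∈ S, M t) ^ p ^ s := by
      rw [hgS, ← Finset.prod_pow]
      exact Finset.prod_dvd_prod_of_dvd _ _ fun t ht => pow_dvd_pow _ (hj t (hST ht))
    have hmon := monic_prod_of_monic S M hSM
    have hnd : ¬ (X ^ (n * p ^ s) - 1 : F[X]) ∣ (∏ t ∈ S, M t) ^ p ^ s := by
      refine not_X_pow_sub_one_dvd (hmon.pow _).ne_zero ?_
      rw [natDegree_pow, hdegS, mul_comm]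
      exact Nat.mul_lt_mul_of_pos_right hlt (by omega)
    have h := hd.trans_le ((dHamming_le_card_support hN hf hdvd hnd).trans
      (card_support_pow_char_pow_le p s _))
    rw [hdegS, hgS, natDegree_prod_pow_eq S hSM, Nat.lt_succ_iff] at h
    have hterm : ∀ t ∈ S, (M t).natDegree ≤ j t * (M t).natDegree := fun t ht =>
      Nat.le_mul_of_pos_left _ (Nat.pos_of_ne_zero (Finset.mem_filter.1 ht).2)
    have heq := (Finset.sum_eq_sum_iff_of_le hterm).1 (le_antisymm (Finset.sum_le_sum hterm) h)
    intro t ht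
    by_cases hjt : j t = 0
    · omega
    · have := heq t (by simp [hS, ht, hjt])
      have hdt := hdpos t ht
      nlinarith
  refine ⟨hle, ?_⟩
  have hdvd : ∏ t ∈ T, M t ^ j t ∣ (X ^ n - 1) ^ 1 := by
    rw [pow_one, ← hprod]
    refine Finset.prod_dvd_prod_of_dvd _ _ fun t ht => ?_
    simpa using pow_dvd_pow (M t) (hle t ht)
  have hnd : ¬ (X ^ (n * p ^ s) - 1 : F[X]) ∣ (X ^ n - 1) ^ 1 := by
    have h0 : (X ^ n - 1 : F[X]) ≠ 0 := hprod ▸ (monic_prod_of_monic _ _ hM).ne_zero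
    rw [pow_one]
    refine not_X_pow_sub_one_dvd h0 ?_
    rw [natDegree_X_pow_sub_one]
    exact lt_mul_of_one_lt_right hn hps
  have h := hd.trans_le ((dHamming_le_card_support hN hf hdvd hnd).trans
    (card_support_X_pow_sub_one_pow_le n 1))
  omega

/-- If every irreducible factor of `X ^ n - 1` occurs in the generator, with exponents that are not
all equal to `p ^ s`, then an MDS code has a single factor of smaller exponent, and that factor is
linear. -/
theorem exists_eq_sub_one_of_natDegree_lt_dHamming (hn : 1 < n)
    (hM : ∀ t ∈ T, (M t).Monic) (hirr : ∀ t ∈ T, Irreducible (M t))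
    (hinj : Set.InjOn M T) (hprod : ∏ t ∈ T, M t = X ^ n - 1) (hj : ∀ t ∈ T, j t ≤ p ^ s)
    (hf : (X ^ (n * p ^ s) - 1 : F[X]) ≠ 0) (hpos : ∀ t ∈ T, 0 < j t)
    (hd : (∏ t ∈ T, M t ^ j t).natDegree <
      dHamming hf (Ideal.span {AdjoinRoot.mk _ (∏ t ∈ T, M t ^ j t)})) :
    ∃ t ∈ T, (M t).natDegree = 1 ∧ j t = p ^ s - 1 ∧ ∀ t' ∈ T, t' ≠ t → j t' = p ^ s := by
  have hN : 0 < n * p ^ s := Nat.mul_pos (by omega) (pow_pos (Fact.out : p.Prime).pos s)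
  have hdpos : ∀ t ∈ T, 0 < (M t).natDegree := fun t ht => (hirr t ht).natDegree_pos
  set A := T.filter fun t => j t = p ^ s with hA
  set B := T.filter fun t => ¬ j t = p ^ s with hB
  have hAT : A ⊆ T := Finset.filter_subset _ _
  have hBT : B ⊆ T := Finset.filter_subset _ _
  have hsplit : ∀ e : ι → ℕ, ∏ t ∈ T, M t ^ e t = (∏ t ∈ A, M t ^ e t) * ∏ t ∈ B, M t ^ e t :=
    fun e => (Finset.prod_filter_mul_prod_filter_not T _ _).symm
  have hprodA : ∏ t ∈ A, M t ^ j t = (∏ t ∈ A, M t) ^ p ^ s := by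
    rw [← Finset.prod_pow]
    exact Finset.prod_congr rfl fun t ht => by rw [(Finset.mem_filter.1 ht).2]
  have hBne : B.Nonempty := by
    by_contra hBe
    rw [Finset.not_nonempty_iff_eq_empty] at hBe
    have hall : ∀ t ∈ T, j t = p ^ s := fun t ht => by
      by_contra h
      exact Finset.notMem_empty t (hBe ▸ Finset.mem_filter.2 ⟨ht, h⟩)
    have hg : ∏ t ∈ T, M t ^ j t = X ^ (n * p ^ s) - 1 := by
      rw [X_pow_sub_one_eq_prod_pow hprod]
      exact Finset.prod_congr rfl fun t ht => by rw [hall t ht]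
    rw [hg, AdjoinRoot.mk_self, Ideal.span_singleton_eq_bot.2 rfl, dHamming_bot] at hd
    exact absurd hd (Nat.not_lt_zero _)
  obtain ⟨t₀, ht₀, hmax⟩ := B.exists_max_image j hBne
  have ht₀T := hBT ht₀
  have hjt₀ : j t₀ < p ^ s := lt_of_le_of_ne (hj _ ht₀T) (Finset.mem_filter.1 ht₀).2
  have hM1 := hpos t₀ ht₀T
  set m := j t₀
  have hmonA := monic_prod_of_monic A M fun t ht => hM t (hAT ht)
  have hmonB := monic_prod_of_monic B M fun t ht => hM t (hBT ht)
  have hAB : (X ^ n - 1 : F[X]) = (∏ t ∈ A, M t) * ∏ t ∈ B, M t := by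
    rw [← hprod]
    exact (Finset.prod_filter_mul_prod_filter_not T _ _).symm
  set hAp := ∏ t ∈ A, M t
  set hBp := ∏ t ∈ B, M t
  have hdvd : ∏ t ∈ T, M t ^ j t ∣ hAp ^ p ^ s * (X ^ n - 1) ^ m := by
    rw [hsplit, hprodA, hAB, mul_pow]
    refine mul_dvd_mul_left _ (Dvd.dvd.mul_left ?_ _)
    rw [← Finset.prod_pow]
    exact Finset.prod_dvd_prod_of_dvd _ _ fun t ht => pow_dvd_pow _ (hmax t ht)
  have hnd : ¬ (X ^ (n * p ^ s) - 1 : F[X]) ∣ hAp ^ p ^ s * (X ^ n - 1) ^ m := by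
    intro h
    rw [X_pow_sub_one_eq_prod_pow hprod, hsplit, Finset.prod_pow, Finset.prod_pow,
      mul_dvd_mul_iff_left (hmonA.pow _).ne_zero, hAB, mul_pow,
      show p ^ s = (p ^ s - m) + m by omega, pow_add,
      mul_dvd_mul_iff_right (hmonB.pow _).ne_zero] at h
    have h1 : M t₀ ∣ hAp ^ m :=
      ((Finset.dvd_prod_of_mem M ht₀).trans (dvd_pow_self _ (by omega))).trans h
    have hprime := (hirr t₀ ht₀T).prime
    obtain ⟨t, ht, hdt⟩ := hprime.exists_mem_finset_dvd (hprime.dvd_of_dvd_pow h1)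
    have : t₀ = t := hinj ht₀T (hAT ht) (eq_of_monic_of_associated (hM _ ht₀T) (hM _ (hAT ht))
      ((hirr t₀ ht₀T).associated_of_dvd (hirr t (hAT ht)) hdt))
    subst this
    exact (Finset.mem_filter.1 ht₀).2 (Finset.mem_filter.1 ht).2
  have h := hd.trans_le ((dHamming_le_card_support hN hf hdvd hnd).trans (card_support_mul_le.trans
    (Nat.mul_le_mul (card_support_pow_char_pow_le p s _) (card_support_X_pow_sub_one_pow_le n m))))
  have hdegn : n = hAp.natDegree + ((M t₀).natDegree + ∑ t ∈ B.erase t₀, (M t).natDegree) := by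
    rw [Finset.add_sum_erase B (fun t => (M t).natDegree) ht₀,
      ← natDegree_prod_of_monic _ _ fun t ht => hM t (hBT ht), ← hmonA.natDegree_mul hmonB, ← hAB,
      natDegree_X_pow_sub_one]
  have hdegg : hAp.natDegree * p ^ s + (m * (M t₀).natDegree +
      ∑ t ∈ B.erase t₀, (M t).natDegree) ≤ (∏ t ∈ T, M t ^ j t).natDegree := by
    have hmonB' := monic_prod_of_monic B (fun t => M t ^ j t) fun t ht => (hM t (hBT ht)).pow _
    rw [hsplit, hprodA, (hmonA.pow _).natDegree_mul hmonB',
      natDegree_prod_pow_eq B fun t ht => hM t (hBT ht),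
      ← Finset.add_sum_erase B (fun t => j t * (M t).natDegree) ht₀, natDegree_pow,
      mul_comm (p ^ s)]
    gcongr with t ht
    exact Nat.le_mul_of_pos_left _ (hpos t (hBT (Finset.mem_of_mem_erase ht)))
  have hd0 := hdpos t₀ ht₀T
  set α := hAp.natDegree
  set d₀ := (M t₀).natDegree with hd₀
  set δ := ∑ t ∈ B.erase t₀, (M t).natDegree with hδ
  obtain ⟨e, he⟩ := Nat.exists_eq_add_of_lt hjt₀
  obtain ⟨d', hd'⟩ := Nat.exists_eq_add_of_lt hd0
  rw [he] at hdegg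
  have hfin : α * e + m * d' + δ ≤ 0 := by
    rw [hd'] at hdegg
    nlinarith
  have hδ0 : δ = 0 := by omega
  have hmd : m * d' = 0 := by omega
  have hd'0 : d' = 0 := (mul_eq_zero.1 hmd).resolve_left (by omega)
  have hα : α ≠ 0 := by omega
  have he0 : e = 0 := (mul_eq_zero.1 (by omega : α * e = 0)).resolve_left hα
  refine ⟨t₀, ht₀T, by omega, by omega, fun t ht hne => ?_⟩
  by_contra hjt
  have htB : t ∈ B.erase t₀ := Finset.mem_erase.2 ⟨hne, Finset.mem_filter.2 ⟨ht, hjt⟩⟩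
  have := (Finset.sum_eq_zero_iff.1 (hδ ▸ hδ0)) t htB
  have := hdpos t ht
  omega

theorem exponents_of_natDegree_lt_dHamming (hn : 1 < n) (hs : 0 < s)
    (hM : ∀ t ∈ T, (M t).Monic) (hirr : ∀ t ∈ T, Irreducible (M t))
    (hinj : Set.InjOn M T) (hprod : ∏ t ∈ T, M t = X ^ n - 1) (hj : ∀ t ∈ T, j t ≤ p ^ s)
    (hf : (X ^ (n * p ^ s) - 1 : F[X]) ≠ 0)
    (hd : (∏ t ∈ T, M t ^ j t).natDegree <
      dHamming hf (Ideal.span {AdjoinRoot.mk _ (∏ t ∈ T, M t ^ j t)})) :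
    (∀ t ∈ T, j t = 0) ∨
      (∃ t ∈ T, (M t).natDegree = 1 ∧ j t = 1 ∧ ∀ t' ∈ T, t' ≠ t → j t' = 0) ∨
      ∃ t ∈ T, (M t).natDegree = 1 ∧ j t = p ^ s - 1 ∧ ∀ t' ∈ T, t' ≠ t → j t' = p ^ s := by
  by_cases hzero : ∃ t ∈ T, j t = 0
  · obtain ⟨t₀, ht₀, hjt₀⟩ := hzero
    obtain ⟨hle, hdeg⟩ := le_one_of_natDegree_lt_dHamming (by omega) hs hM hirr hprod hj hf ht₀ hjt₀ hd
    by_cases hall : ∀ t ∈ T, j t = 0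
    · exact Or.inl hall
    push Not at hall
    obtain ⟨t, ht, hjt⟩ := hall
    have hjt1 : j t = 1 := by have := hle t ht; omega
    rw [natDegree_prod_pow_eq T hM, ← Finset.add_sum_erase _ _ ht, hjt1, one_mul] at hdeg
    have hdt := (hirr t ht).natDegree_pos
    refine Or.inr (Or.inl ⟨t, ht, by omega, hjt1, fun t' ht' hne => ?_⟩)
    have h0 := Finset.sum_eq_zero_iff.1 (by omega : ∑ x ∈ T.erase t, j x * (M x).natDegree = 0) t'
      (Finset.mem_erase.2 ⟨hne, ht'⟩)
    exact (mul_eq_zero.1 h0).resolve_right (hirr t' ht').natDegree_pos.ne'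
  · push Not at hzero
    exact Or.inr (Or.inr (exists_eq_sub_one_of_natDegree_lt_dHamming hn hM hirr hinj hprod hj hf
      (fun t ht => Nat.pos_of_ne_zero (hzero t ht)) hd))

theorem exists_eq_X_sub_C_of_natDegree_eq_one (hM : ∀ t ∈ T, (M t).Monic)
    (hprod : ∏ t ∈ T, M t = X ^ n - 1) {t : ι} (ht : t ∈ T) (hdt : (M t).natDegree = 1) :
    ∃ c : F, c ^ n = 1 ∧ M t = X - C c := by
  have h := (hM t ht).eq_X_add_C hdt
  refine ⟨-(M t).coeff 0, ?_, by rw [C_neg, sub_neg_eq_add]; exact h⟩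
  have hdvd : X - C (-(M t).coeff 0) ∣ (X ^ n - 1 : F[X]) := by
    rw [C_neg, sub_neg_eq_add, ← h, ← hprod]
    exact Finset.dvd_prod_of_mem M ht
  rw [dvd_iff_isRoot] at hdvd
  simpa [sub_eq_zero] using hdvd

theorem prod_pow_eq_one (h : ∀ t ∈ T, j t = 0) : ∏ t ∈ T, M t ^ j t = 1 :=
  Finset.prod_eq_one fun t ht => by rw [h t ht, pow_zero]

theorem prod_pow_eq_self {t : ι} (ht : t ∈ T) (hjt : j t = 1)
    (h : ∀ t' ∈ T, t' ≠ t → j t' = 0) : ∏ t ∈ T, M t ^ j t = M t := by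
  rw [Finset.prod_eq_single_of_mem t ht fun t' ht' hne => by rw [h t' ht' hne, pow_zero], hjt,
    pow_one]

theorem prod_pow_mul_eq_X_pow_sub_one (hprod : ∏ t ∈ T, M t = X ^ n - 1) {t : ι} (ht : t ∈ T)
    (hjt : j t = p ^ s - 1) (h : ∀ t' ∈ T, t' ≠ t → j t' = p ^ s) :
    (∏ t ∈ T, M t ^ j t) * M t = X ^ (n * p ^ s) - 1 := by
  rw [X_pow_sub_one_eq_prod_pow hprod, ← Finset.mul_prod_erase T _ ht,
    ← Finset.mul_prod_erase T (fun t => M t ^ p ^ s) ht, mul_right_comm, hjt, ← pow_succ,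
    Nat.sub_add_cancel (Nat.one_le_pow _ _ (Fact.out : p.Prime).pos)]
  congr 1
  exact Finset.prod_congr rfl fun t' ht' => by
    rw [h t' (Finset.mem_of_mem_erase ht') (Finset.ne_of_mem_erase ht')]

end Factored

end CyclicCodes

/-- for `q = p^m = 2^a·b−1` with `a ≥ 2` and `r ≥ 3`, the cyclic code
`C = ⟨m_0^{j_0}·m_{2^{r−1}}^{j_{2^{r−1}}}·m_{2^{r−2}}^{j_{2^{r−2}}}·∏_{i=3}^r ∏_{u∈O_i} m_{2^{r−i}u}^{j_{2^{r−i}u}}⟩`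
of length `2^r·p^s` is MDS iff exactly one of: (1) all `j_t = 0` (then `d_H(C) = 1`);
(2) exactly one of `j_0, j_{2^{r−1}}` is `1` and all other exponents are `0`
(then `d_H(C) = 2`); (3) exactly one of `j_0, j_{2^{r−1}}` is `p^s − 1` and all other
exponents are `p^s` (then `d_H(C) = 2^r·p^s`). -/
theorem stmt17 (p m a b r s : ℕ) (hp : p.Prime) (hpodd : Odd p) (hm : 0 < m) (hs : 0 < s)
    (hb : Odd b) (ha : 2 ≤ a) (hr : 3 ≤ r) (hq : (p : ℤ) ^ m = 2 ^ a * b - 1)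
    (F : Type*) [Field F] [Fintype F] (hF : Fintype.card F = p ^ m)
    (E : Type*) [Field E] [Algebra F E] (β : E) (hβ : IsPrimitiveRoot β (2 ^ r))
    (N : ℕ) (hN : N = 2 ^ r * p ^ s) (hf : (X ^ N - 1 : Polynomial F) ≠ 0)
    (j : ℤ → ℕ) (hj : ∀ t ∈ TnO a r, j t ≤ p ^ s)
    (C : Ideal (AdjoinRoot (X ^ N - 1 : Polynomial F)))
    (hC : C = Ideal.span {AdjoinRoot.mk (X ^ N - 1 : Polynomial F)
      (minpoly F (β ^ (0 : ℤ)) ^ j 0 *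
        minpoly F (β ^ ((2 : ℤ) ^ (r - 1))) ^ j (2 ^ (r - 1)) *
        minpoly F (β ^ ((2 : ℤ) ^ (r - 2))) ^ j (2 ^ (r - 2)) *
        ∏ i ∈ Finset.Icc 3 r, ∏ u ∈ Ofin a i,
          minpoly F (β ^ ((2 : ℤ) ^ (r - i) * u)) ^ j (2 ^ (r - i) * u))}) :
    (dHamming hf C = N - Module.finrank F (Submodule.restrictScalars F C) + 1 ↔
      (∀ t ∈ TnO a r, j t = 0) ∨
      (∃ t ∈ ({0, 2 ^ (r - 1)} : Finset ℤ), j t = 1 ∧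
        ∀ t' ∈ TnO a r, t' ≠ t → j t' = 0) ∨
      (∃ t ∈ ({0, 2 ^ (r - 1)} : Finset ℤ), j t = p ^ s - 1 ∧
        ∀ t' ∈ TnO a r, t' ≠ t → j t' = p ^ s)) ∧
    ((∀ t ∈ TnO a r, j t = 0) → dHamming hf C = 1) ∧
    ((∃ t ∈ ({0, 2 ^ (r - 1)} : Finset ℤ), j t = 1 ∧
        ∀ t' ∈ TnO a r, t' ≠ t → j t' = 0) → dHamming hf C = 2) ∧
    ((∃ t ∈ ({0, 2 ^ (r - 1)} : Finset ℤ), j t = p ^ s - 1 ∧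
        ∀ t' ∈ TnO a r, t' ≠ t → j t' = p ^ s) → dHamming hf C = 2 ^ r * p ^ s) := by
  have : Fact p.Prime := ⟨hp⟩
  have : CharP F p := charP_of_card_eq_prime_pow hF
  have hq' : (Fintype.card F : ℤ) = 2 ^ a * b - 1 := by rw [hF]; exact_mod_cast hq
  have hbz : Odd (b : ℤ) := by exact_mod_cast hb
  have hn : 1 < 2 ^ r := Nat.one_lt_two_pow (by omega)
  have hps : 1 < p ^ s := Nat.one_lt_pow hs.ne' hp.one_lt
  subst hN
  have hN1 : 1 < 2 ^ r * p ^ s := by nlinarith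
  have hint := isIntegral_zpow_of_isPrimitiveRoot (F := F) (by positivity) hβ
  set M : ℤ → F[X] := fun t => minpoly F (β ^ t)
  have hM : ∀ t ∈ TnO a r, (M t).Monic := fun t _ => minpoly.monic (hint t)
  have hirr : ∀ t ∈ TnO a r, Irreducible (M t) := fun t _ => minpoly.irreducible (hint t)
  have hinj : Set.InjOn M (TnO a r) := minpoly_zpow_injOn_TnO ha hbz hq' hr hβ
  have hprod : ∏ t ∈ TnO a r, M t = X ^ 2 ^ r - 1 := prod_minpoly_zpow_TnO ha hbz hq' hr hβ
  have hdeg1 : ∀ t ∈ TnO a r, (M t).natDegree = 1 ↔ t ∈ ({0, 2 ^ (r - 1)} : Finset ℤ) :=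
    fun t ht => natDegree_minpoly_zpow_eq_one_iff ha hbz hq' hr hβ ht
  have hsub : ({0, 2 ^ (r - 1)} : Finset ℤ) ⊆ TnO a r := fun t ht => by
    rw [Finset.mem_insert, Finset.mem_singleton] at ht
    rcases ht with rfl | rfl <;> simp [TnO]
  rw [← prod_TnO ha hr fun t => M t ^ j t] at hC
  subst hC
  set g := ∏ t ∈ TnO a r, M t ^ j t
  have hg : g ∣ X ^ (2 ^ r * p ^ s) - 1 := by
    rw [X_pow_sub_one_eq_prod_pow hprod]
    exact Finset.prod_dvd_prod_of_dvd _ _ fun t ht => pow_dvd_pow _ (hj t ht)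
  have hrank := finrank_span_mk_add_natDegree hf hg
  rw [natDegree_X_pow_sub_one] at hrank
  have hlin : ∀ t ∈ ({0, 2 ^ (r - 1)} : Finset ℤ), ∃ c : F, c ^ (2 ^ r * p ^ s) = 1 ∧
      M t = X - C c := fun t ht => by
    obtain ⟨c, hc, h⟩ :=
      exists_eq_X_sub_C_of_natDegree_eq_one hM hprod (hsub ht) ((hdeg1 t (hsub ht)).2 ht)
    exact ⟨c, by rw [pow_mul, hc, one_pow], h⟩
  have case1 : (∀ t ∈ TnO a r, j t = 0) →
      dHamming hf (Ideal.span {AdjoinRoot.mk _ g}) = 1 ∧ g.natDegree + 1 = 1 := fun h => by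
    rw [show g = 1 from prod_pow_eq_one h]
    exact ⟨dHamming_span_mk_one (by omega) hf, by simp⟩
  have case2 : (∃ t ∈ ({0, 2 ^ (r - 1)} : Finset ℤ), j t = 1 ∧
      ∀ t' ∈ TnO a r, t' ≠ t → j t' = 0) →
      dHamming hf (Ideal.span {AdjoinRoot.mk _ g}) = 2 ∧ g.natDegree + 1 = 2 := by
    rintro ⟨t, ht, hjt, h⟩
    obtain ⟨c, hc, hMt⟩ := hlin t ht
    rw [show g = X - C c from (prod_pow_eq_self (hsub ht) hjt h).trans hMt]
    exact ⟨dHamming_span_mk_X_sub_C hN1 hf hc, by simp⟩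
  have case3 : (∃ t ∈ ({0, 2 ^ (r - 1)} : Finset ℤ), j t = p ^ s - 1 ∧
      ∀ t' ∈ TnO a r, t' ≠ t → j t' = p ^ s) →
      dHamming hf (Ideal.span {AdjoinRoot.mk _ g}) = 2 ^ r * p ^ s ∧
        g.natDegree + 1 = 2 ^ r * p ^ s := by
    rintro ⟨t, ht, hjt, h⟩
    obtain ⟨c, hc, hMt⟩ := hlin t ht
    have hgc : g * (X - C c) = X ^ (2 ^ r * p ^ s) - 1 :=
      hMt ▸ prod_pow_mul_eq_X_pow_sub_one hprod (hsub ht) hjt h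
    refine ⟨dHamming_span_mk_of_mul_X_sub_C (by omega) hf hc hgc, ?_⟩
    have hdeg := natDegree_X_pow_sub_one (F := F) (2 ^ r * p ^ s)
    rwa [← hgc, natDegree_mul (ne_zero_of_dvd_ne_zero hf hg) (X_sub_C_ne_zero c),
      natDegree_X_sub_C] at hdeg
  refine ⟨⟨fun hd => ?_, ?_⟩, fun h => (case1 h).1, fun h => (case2 h).1, fun h => (case3 h).1⟩
  · have hlt : g.natDegree < dHamming hf (Ideal.span {AdjoinRoot.mk _ g}) := by omega
    rcases exponents_of_natDegree_lt_dHamming hn hs hM hirr hinj hprod hj hf hlt with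
      h | ⟨t, ht, hdt, h⟩ | ⟨t, ht, hdt, h⟩
    · exact Or.inl h
    · exact Or.inr (Or.inl ⟨t, (hdeg1 t ht).1 hdt, h⟩)
    · exact Or.inr (Or.inr ⟨t, (hdeg1 t ht).1 hdt, h⟩)
  · rintro (h | h | h)
    · have := case1 h
      omega
    · have := case2 h
      omega
    · have := case3 h
      omega
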